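/- arXiv:1603.00204 — 2 statements merged into one kernel-verified Lean document; each statement's English description precedes it below -/
import Mathlib

section
/- Let N ≥ 1, let Ω ⊆ ℝ^N be an open set, and let u : ℝ^N → ℝ be three times continuously differentiable on Ω with Δu(x) = -1 for all x ∈ Ω. Then the function P(x) := ‖∇u(x)‖² satisfies ΔP(x) ≥ 2/N for all x ∈ Ω; in particular P is strictly subharmonic on Ω. -/
noncomputable section

/-- The `(i,j)` entry of the Hessian of `u : ℝ^N → ℝ` at `x`, i.e. `∂²u/∂x_i∂x_j (x)`. -/
def hessEntry {N : ℕ} (u : EuclideanSpace ℝ (Fin N) → ℝ) (x : EuclideanSpace ℝ (Fin N))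
    (i j : Fin N) : ℝ :=
  fderiv ℝ (fun y => fderiv ℝ u y (EuclideanSpace.single j 1)) x (EuclideanSpace.single i 1)

/-- The Laplacian of `u : ℝ^N → ℝ` at `x`: the trace of the Hessian of `u` at `x`. -/
def lap {N : ℕ} (u : EuclideanSpace ℝ (Fin N) → ℝ) (x : EuclideanSpace ℝ (Fin N)) : ℝ :=
  ∑ i, hessEntry u x i i

section DirectionalDerivatives

variable {E : Type*} [NormedAddCommGroup E] [NormedSpace ℝ E]

lemma ContDiffAt.fderiv_apply_const {f : E → ℝ} {x : E} {m n : WithTop ℕ∞}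
    (hf : ContDiffAt ℝ n f x) (hmn : m + 1 ≤ n) (v : E) :
    ContDiffAt ℝ m (fun y => fderiv ℝ f y v) x :=
  (hf.fderiv_right hmn).clm_apply contDiffAt_const

lemma fderiv_fderiv_apply_comm {f : E → ℝ} {x : E} (hf : ContDiffAt ℝ 2 f x) (v w : E) :
    fderiv ℝ (fun y => fderiv ℝ f y w) x v = fderiv ℝ (fun y => fderiv ℝ f y v) x w := by
  have hd : DifferentiableAt ℝ (fderiv ℝ f) x :=
    (hf.fderiv_right (m := 1) (by norm_num)).differentiableAt (by norm_num)
  have hs : IsSymmSndFDerivAt ℝ f x := hf.isSymmSndFDerivAt (by simp)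
  rw [fderiv_clm_apply hd (differentiableAt_const w),
    fderiv_clm_apply hd (differentiableAt_const v)]
  simpa using hs v w

lemma fderiv_sq_apply {f : E → ℝ} {x : E} (hf : DifferentiableAt ℝ f x) (v : E) :
    fderiv ℝ (fun y => f y ^ 2) x v = 2 * f x * fderiv ℝ f x v := by
  rw [fderiv_fun_pow 2 hf]
  simp

lemma fderiv_fderiv_sq_apply {f : E → ℝ} {x : E} (hf : ContDiffAt ℝ 2 f x) (v : E) :
    fderiv ℝ (fun y => fderiv ℝ (fun z => f z ^ 2) y v) x v =
      2 * (fderiv ℝ f x v) ^ 2 + 2 * f x * fderiv ℝ (fun y => fderiv ℝ f y v) x v := by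
  have hev : (fun y => fderiv ℝ (fun z => f z ^ 2) y v) =ᶠ[nhds x]
      fun y => 2 * f y * fderiv ℝ f y v := by
    filter_upwards [hf.eventually (by simp)] with y hy
    exact fderiv_sq_apply (hy.differentiableAt (by norm_num)) v
  have h1 : DifferentiableAt ℝ f x := hf.differentiableAt (by norm_num)
  have h2 : DifferentiableAt ℝ (fun y => fderiv ℝ f y v) x :=
    (hf.fderiv_apply_const (m := 1) (by norm_num) v).differentiableAt (by norm_num)
  rw [hev.fderiv_eq, fderiv_fun_mul (h1.const_mul 2) h2, fderiv_const_mul h1]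
  simp
  ring

end DirectionalDerivatives

section Laplacian

variable {N : ℕ} {x : EuclideanSpace ℝ (Fin N)}

lemma lap_sq {f : EuclideanSpace ℝ (Fin N) → ℝ} (hf : ContDiffAt ℝ 2 f x) :
    lap (fun y => f y ^ 2) x =
      2 * ∑ i, (fderiv ℝ f x (EuclideanSpace.single i 1)) ^ 2 + 2 * f x * lap f x := by
  simp only [lap, hessEntry, fderiv_fderiv_sq_apply hf, Finset.sum_add_distrib, Finset.mul_sum]

lemma lap_sum {ι : Type*} (s : Finset ι) {f : ι → EuclideanSpace ℝ (Fin N) → ℝ}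
    (hf : ∀ j ∈ s, ContDiffAt ℝ 2 (f j) x) :
    lap (fun y => ∑ j ∈ s, f j y) x = ∑ j ∈ s, lap (f j) x := by
  have hev (v : EuclideanSpace ℝ (Fin N)) :
      (fun y => fderiv ℝ (fun z => ∑ j ∈ s, f j z) y v) =ᶠ[nhds x]
        fun y => ∑ j ∈ s, fderiv ℝ (f j) y v := by
    filter_upwards [(Filter.eventually_all_finset s).2
      fun j hj => (hf j hj).eventually (by simp)] with y hy
    rw [fderiv_fun_sum fun j hj => (hy j hj).differentiableAt (by norm_num)]
    simp
  have hd (v : EuclideanSpace ℝ (Fin N)) : ∀ j ∈ s,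
      DifferentiableAt ℝ (fun y => fderiv ℝ (f j) y v) x := fun j hj =>
    ((hf j hj).fderiv_apply_const (m := 1) (by norm_num) v).differentiableAt (by norm_num)
  simp only [lap, hessEntry, (hev _).fderiv_eq, fderiv_fun_sum (hd _)]
  simp only [sum_apply]
  exact Finset.sum_comm

lemma lap_fderiv_apply {u : EuclideanSpace ℝ (Fin N) → ℝ} (hu : ContDiffAt ℝ 3 u x)
    (v : EuclideanSpace ℝ (Fin N)) :
    lap (fun y => fderiv ℝ u y v) x = fderiv ℝ (lap u) x v := by
  have hc (w : EuclideanSpace ℝ (Fin N)) : ContDiffAt ℝ 2 (fun y => fderiv ℝ u y w) x :=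
    hu.fderiv_apply_const (by norm_num) w
  have hd (w : EuclideanSpace ℝ (Fin N)) :
      DifferentiableAt ℝ (fun y => fderiv ℝ (fun z => fderiv ℝ u z w) y w) x :=
    ((hc w).fderiv_apply_const (m := 1) (by norm_num) w).differentiableAt (by norm_num)
  have hev (w : EuclideanSpace ℝ (Fin N)) :
      (fun y => fderiv ℝ (fun z => fderiv ℝ u z v) y w) =ᶠ[nhds x]
        fun y => fderiv ℝ (fun z => fderiv ℝ u z w) y v := by
    filter_upwards [hu.eventually (by simp)] with y hy
    exact fderiv_fderiv_apply_comm (hy.of_le (by norm_num)) w v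
  have hlap : lap u = fun y => ∑ i, fderiv ℝ (fun z => fderiv ℝ u z (EuclideanSpace.single i 1)) y
      (EuclideanSpace.single i 1) := rfl
  rw [hlap, fderiv_fun_sum fun i _ => hd _]
  simp only [lap, hessEntry, sum_apply]
  refine Finset.sum_congr rfl fun i _ => ?_
  rw [(hev _).fderiv_eq, fderiv_fderiv_apply_comm (hc _)]

lemma norm_gradient_sq_eq_sum (u : EuclideanSpace ℝ (Fin N) → ℝ)
    (y : EuclideanSpace ℝ (Fin N)) :
    ‖gradient u y‖ ^ 2 = ∑ j, (fderiv ℝ u y (EuclideanSpace.single j 1)) ^ 2 := by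
  rw [EuclideanSpace.real_norm_sq_eq]
  refine Finset.sum_congr rfl fun j _ => ?_
  have h : inner ℝ (gradient u y) (EuclideanSpace.single j 1) =
      fderiv ℝ u y (EuclideanSpace.single j 1) := by
    rw [gradient, InnerProductSpace.toDual_symm_apply]
  rw [← h, EuclideanSpace.inner_single_right]
  simp

/-- The Bochner formula in Euclidean space. -/
lemma lap_sq_norm_gradient {u : EuclideanSpace ℝ (Fin N) → ℝ} (hu : ContDiffAt ℝ 3 u x) :
    lap (fun y => ‖gradient u y‖ ^ 2) x =
      2 * ∑ j, ∑ i, hessEntry u x i j ^ 2 +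
        2 * ∑ j, fderiv ℝ u x (EuclideanSpace.single j 1) *
          fderiv ℝ (lap u) x (EuclideanSpace.single j 1) := by
  have hc (w : EuclideanSpace ℝ (Fin N)) : ContDiffAt ℝ 2 (fun y => fderiv ℝ u y w) x :=
    hu.fderiv_apply_const (by norm_num) w
  simp only [norm_gradient_sq_eq_sum]
  rw [lap_sum _ fun j _ => (hc _).pow 2]
  simp only [lap_sq (hc _), lap_fderiv_apply hu, Finset.sum_add_distrib, Finset.mul_sum, hessEntry,
    mul_assoc]

lemma sq_lap_le_card_mul_sum_sq_hessEntry (u : EuclideanSpace ℝ (Fin N) → ℝ) :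
    lap u x ^ 2 ≤ N * ∑ j, ∑ i, hessEntry u x i j ^ 2 := by
  calc lap u x ^ 2 ≤ N * ∑ j, hessEntry u x j j ^ 2 := by
        simpa [lap] using sq_sum_le_card_mul_sum_sq (s := Finset.univ)
          (f := fun j => hessEntry u x j j)
    _ ≤ N * ∑ j, ∑ i, hessEntry u x i j ^ 2 := by
        gcongr with j
        exact Finset.single_le_sum (f := fun i => hessEntry u x i j ^ 2)
          (fun i _ => sq_nonneg _) (Finset.mem_univ j)

end Laplacian

/-- If `u` is three times continuously differentiable on an open set `Ω ⊆ ℝ^N` and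
`Δu = -1` on `Ω`, then `P := ‖∇u‖²` satisfies `ΔP ≥ 2/N` on `Ω`; in particular `P`
is strictly subharmonic on `Ω`. -/
theorem lap_sq_norm_gradient_ge {N : ℕ} (hN : 1 ≤ N) {Ω : Set (EuclideanSpace ℝ (Fin N))}
    (hΩ : IsOpen Ω) {u : EuclideanSpace ℝ (Fin N) → ℝ} (hu : ContDiffOn ℝ 3 u Ω)
    (hΔu : ∀ x ∈ Ω, lap u x = -1) :
    ∀ x ∈ Ω, 2 / (N : ℝ) ≤ lap (fun y => ‖gradient u y‖ ^ 2) x := by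
  intro x hx
  have hN' : (0 : ℝ) < N := by exact_mod_cast hN
  have hlap : lap u =ᶠ[nhds x] fun _ => -1 := by
    filter_upwards [hΩ.mem_nhds hx] with y hy using hΔu y hy
  have hle := sq_lap_le_card_mul_sum_sq_hessEntry (x := x) u
  rw [hΔu x hx] at hle
  rw [lap_sq_norm_gradient (hu.contDiffAt (hΩ.mem_nhds hx)), hlap.fderiv_eq, div_le_iff₀ hN']
  simp only [fderiv_fun_const, Pi.zero_apply, zero_apply, mul_zero,
    Finset.sum_const_zero, add_zero]
  linarith

end
end

section
/- (Euclidean case of Theorem 2: Ω is self-Cheeger.) Let N ≥ 2, let Ω ⊆ ℝ^N be a nonempty bounded open set whose topological boundary ∂Ω is a compact C² hypersurface, let λ > 0, and let u : ℝ^N → ℝ be twice continuously differentiable on an open neighborhood of the closure of Ω with Δu(x) = -1 for all x ∈ Ω, u(x) = 0 and ‖∇u(x)‖ = λ for all x ∈ ∂Ω. Then for every measurable set A ⊆ Ω one has vol(A) ≤ λ · P(A), where P(A) denotes the variational perimeter of A; moreover P(Ω) = vol(Ω)/λ, so that the Cheeger constant h(Ω) := inf { P(A)/vol(A) : A ⊆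 Ω measurable, vol(A) > 0, P(A) < ∞ } equals 1/λ and is attained by A = Ω. -/
open MeasureTheory
open scoped ENNReal

noncomputable section

/-- The divergence of a vector field `ξ : ℝ^N → ℝ^N` at `x`: the trace of its derivative. -/
def diverg {N : ℕ} (ξ : EuclideanSpace ℝ (Fin N) → EuclideanSpace ℝ (Fin N))
    (x : EuclideanSpace ℝ (Fin N)) : ℝ :=
  ∑ i, fderiv ℝ ξ x (EuclideanSpace.single i 1) i

/-- The variational perimeter of a set `A ⊆ ℝ^N`:
`P(A) = sup { ∫_A div ξ : ξ ∈ C¹(ℝ^N, ℝ^N), ‖ξ‖ ≤ 1 }`. -/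
def perimeter {N : ℕ} (A : Set (EuclideanSpace ℝ (Fin N))) : ℝ≥0∞ :=
  ⨆ ξ : {ξ : EuclideanSpace ℝ (Fin N) → EuclideanSpace ℝ (Fin N) //
      ContDiff ℝ 1 ξ ∧ ∀ x, ‖ξ x‖ ≤ 1},
    ENNReal.ofReal (∫ x in A, diverg ξ.1 x)

/-- The Cheeger constant of `Ω ⊆ ℝ^N`:
`h(Ω) = inf { P(A)/vol(A) : A ⊆ Ω measurable, vol(A) > 0, P(A) < ∞ }`. -/
def cheegerConstant {N : ℕ} (Ω : Set (EuclideanSpace ℝ (Fin N))) : ℝ≥0∞ :=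
  ⨅ A ∈ {A : Set (EuclideanSpace ℝ (Fin N)) |
      A ⊆ Ω ∧ MeasurableSet A ∧ 0 < volume A ∧ perimeter A < ⊤},
    perimeter A / volume A

/-- `S ⊆ ℝ^N` is a `C²` hypersurface: near each of its points, `S` is the zero set of a
`C²` defining function with nonvanishing differential. -/
def IsC2Hypersurface {N : ℕ} (S : Set (EuclideanSpace ℝ (Fin N))) : Prop :=
  ∀ x ∈ S, ∃ (U : Set (EuclideanSpace ℝ (Fin N))) (f : EuclideanSpace ℝ (Fin N) → ℝ),
    IsOpen U ∧ x ∈ U ∧ ContDiff ℝ 2 f ∧ (∀ y ∈ U, (y ∈ S ↔ f y = 0)) ∧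
    ∀ y ∈ U, fderiv ℝ f y ≠ 0

open Set Filter Topology Metric

section SecondOrder

variable {N : ℕ} {u : EuclideanSpace ℝ (Fin N) → ℝ} {x : EuclideanSpace ℝ (Fin N)}

lemma ContDiffAt.differentiableAt_fderiv_apply (hu : ContDiffAt ℝ 2 u x)
    (v : EuclideanSpace ℝ (Fin N)) :
    DifferentiableAt ℝ (fun y => fderiv ℝ u y v) x :=
  ((hu.fderiv_right (m := 1) (by norm_num)).differentiableAt (by norm_num)).clm_apply
    (differentiableAt_const v)

lemma ContDiffAt.eventually_differentiableAt (hu : ContDiffAt ℝ 2 u x) :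
    ∀ᶠ y in 𝓝 x, DifferentiableAt ℝ u y :=
  (hu.eventually (by simp)).mono fun _ hy => hy.differentiableAt (by norm_num)

lemma hessEntry_self_nonpos_of_isLocalMax (hu : ContDiffAt ℝ 2 u x) (hmax : IsLocalMax u x)
    (i : Fin N) : hessEntry u x i i ≤ 0 := by
  set e : EuclideanSpace ℝ (Fin N) := EuclideanSpace.single i 1 with he
  have hline : ∀ t : ℝ, HasDerivAt (fun t : ℝ => x + t • e) e t := fun t => by
    simpa using ((hasDerivAt_id t).smul_const e).const_add x
  have hx0 : x + (0 : ℝ) • e = x := by simp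
  have hlim : Tendsto (fun t : ℝ => x + t • e) (𝓝 0) (𝓝 x) := by
    simpa using (hline 0).continuousAt.tendsto
  set g : ℝ → ℝ := fun t => u (x + t • e) with hg
  have hg1 : deriv g =ᶠ[𝓝 0] fun t => fderiv ℝ u (x + t • e) e := by
    filter_upwards [hlim.eventually hu.eventually_differentiableAt] with t ht
    exact (ht.hasFDerivAt.comp_hasDerivAt t (hline t)).deriv
  have hg2 : deriv (deriv g) 0 = hessEntry u x i i := by
    rw [hg1.deriv_eq]
    have h := hu.differentiableAt_fderiv_apply e
    rw [← hx0] at h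
    have := (h.hasFDerivAt.comp_hasDerivAt (0 : ℝ) (hline 0)).deriv
    rw [hx0] at this
    exact this
  have hgmax : IsLocalMax g 0 := by
    have := hlim.eventually hmax
    filter_upwards [this] with t ht
    simpa [hg] using ht
  by_contra! hpos
  have hgc : ContinuousAt g 0 :=
    ContinuousAt.comp (g := u) (by rw [hx0]; exact hu.continuousAt) (hline 0).continuousAt
  have hgmin : IsLocalMin g 0 :=
    isLocalMin_of_deriv_deriv_pos (by rw [hg2]; exact hpos) hgmax.deriv_eq_zero hgc
  have hconst : g =ᶠ[𝓝 0] fun _ => g 0 := by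
    filter_upwards [hgmin, hgmax] with t h1 h2
    exact le_antisymm h2 h1
  have : deriv (deriv g) 0 = 0 := by
    rw [hconst.deriv.deriv_eq]
    simp
  linarith

lemma lap_nonpos_of_isLocalMax (hu : ContDiffAt ℝ 2 u x) (hmax : IsLocalMax u x) :
    lap u x ≤ 0 :=
  Finset.sum_nonpos fun i _ => hessEntry_self_nonpos_of_isLocalMax hu hmax i

lemma lap_sub_const_mul {a b : EuclideanSpace ℝ (Fin N) → ℝ} (ha : ContDiffAt ℝ 2 a x)
    (hb : ContDiffAt ℝ 2 b x) (c : ℝ) :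
    lap (fun y => a y - c * b y) x = lap a x - c * lap b x := by
  simp only [lap, Finset.mul_sum, ← Finset.sum_sub_distrib]
  refine Finset.sum_congr rfl fun i _ => ?_
  set e : EuclideanSpace ℝ (Fin N) := EuclideanSpace.single i 1 with he
  have h1 : (fun y => fderiv ℝ (fun y => a y - c * b y) y e) =ᶠ[𝓝 x]
      fun y => fderiv ℝ a y e - c * fderiv ℝ b y e := by
    filter_upwards [ha.eventually_differentiableAt, hb.eventually_differentiableAt] with y h1 h2
    rw [(h1.hasFDerivAt.fun_sub (h2.hasFDerivAt.const_mul c)).fderiv]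
    simp
  have h2 := ((ha.differentiableAt_fderiv_apply e).hasFDerivAt.fun_sub
    ((hb.differentiableAt_fderiv_apply e).hasFDerivAt.const_mul c)).fderiv
  simp only [hessEntry]
  rw [h1.fderiv_eq, h2]
  simp [he]

lemma lap_comp_add_right (w : EuclideanSpace ℝ (Fin N)) :
    lap (fun y => u (y + w)) x = lap u (x + w) := by
  simp only [lap, hessEntry, fderiv_comp_add_right]
  refine Finset.sum_congr rfl fun i _ => ?_
  rw [fderiv_comp_add_right (f := fun y => fderiv ℝ u y (EuclideanSpace.single i 1)) w]

/-- Weak maximum principle for strictly subharmonic functions. -/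
lemma le_of_lap_pos {W : Set (EuclideanSpace ℝ (Fin N))} (hW : IsOpen W)
    (hWb : Bornology.IsBounded W) {f : EuclideanSpace ℝ (Fin N) → ℝ}
    (hfc : ContinuousOn f (closure W)) (hf : ∀ y ∈ W, ContDiffAt ℝ 2 f y)
    (hlap : ∀ y ∈ W, 0 < lap f y) {M : ℝ} (hM : ∀ y ∈ frontier W, f y ≤ M) (hx : x ∈ W) :
    f x ≤ M := by
  obtain ⟨y, hy, hmax⟩ := hWb.isCompact_closure.exists_isMaxOn ⟨x, subset_closure hx⟩ hfc
  have hyW : y ∉ W := fun hyW => by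
    have : IsLocalMax f y :=
      hmax.isLocalMax (mem_of_superset (hW.mem_nhds hyW) subset_closure)
    linarith [lap_nonpos_of_isLocalMax (hf y hyW) this, hlap y hyW]
  have : y ∈ frontier W := by rw [hW.frontier_eq]; exact ⟨hy, hyW⟩
  exact (hmax (subset_closure hx)).trans (hM y this)

end SecondOrder

section Torsion

variable {N : ℕ} {Ω V : Set (EuclideanSpace ℝ (Fin N))} {lam : ℝ}
  {u : EuclideanSpace ℝ (Fin N) → ℝ}

lemma isOpen_sep_norm_fderiv_lt (hV : IsOpen V) (hu : ContDiffOn ℝ 2 u V) (c : ℝ) :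
    IsOpen {y ∈ V | ‖fderiv ℝ u y‖ < c} :=
  (hu.continuousOn_fderiv_of_isOpen hV (by norm_num)).norm.isOpen_inter_preimage hV isOpen_Iio

lemma pos_of_lap_eq_neg_one (hΩ : IsOpen Ω) (hbd : Bornology.IsBounded Ω) (hV : IsOpen V)
    (hΩV : closure Ω ⊆ V) (hu : ContDiffOn ℝ 2 u V) (hΔu : ∀ x ∈ Ω, lap u x = -1)
    (hu0 : ∀ x ∈ frontier Ω, u x = 0) {x : EuclideanSpace ℝ (Fin N)} (hx : x ∈ Ω) :
    0 < u x := by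
  have hC : ∀ y ∈ Ω, ContDiffAt ℝ 2 u y := fun y hy =>
    hu.contDiffAt (hV.mem_nhds (hΩV (subset_closure hy)))
  have hlap : ∀ y ∈ Ω, lap (fun z => 0 - 1 * u z) y = 1 := fun y hy => by
    rw [lap_sub_const_mul contDiffAt_const (hC y hy), hΔu y hy]
    simp [lap, hessEntry]
  have hneg : ∀ y ∈ Ω, ContDiffAt ℝ 2 (fun z => 0 - 1 * u z) y := fun y hy =>
    contDiffAt_const.sub (contDiffAt_const.mul (hC y hy))
  have hnn : ∀ y ∈ Ω, 0 ≤ u y := fun y hy => by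
    have := le_of_lap_pos (f := fun z => 0 - 1 * u z) (M := 0) hΩ hbd
      (continuousOn_const.sub (continuousOn_const.mul (hu.continuousOn.mono hΩV)))
      hneg (fun z hz => by rw [hlap z hz]; norm_num) (fun z hz => by simp [hu0 z hz]) hy
    linarith
  refine (hnn x hx).lt_of_ne fun h0 => ?_
  have hmax : IsLocalMax (fun z => 0 - 1 * u z) x := by
    filter_upwards [hΩ.mem_nhds hx] with y hy
    linarith [hnn y hy]
  linarith [lap_nonpos_of_isLocalMax (hneg x hx) hmax, hlap x hx]

lemma norm_fderiv_le_of_lap_eq_neg_one (hΩ : IsOpen Ω) (hbd : Bornology.IsBounded Ω)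
    (hV : IsOpen V) (hΩV : closure Ω ⊆ V) (hu : ContDiffOn ℝ 2 u V)
    (hΔu : ∀ x ∈ Ω, lap u x = -1) (hu0 : ∀ x ∈ frontier Ω, u x = 0) (hlam : 0 < lam)
    (hgrad : ∀ x ∈ frontier Ω, ‖fderiv ℝ u x‖ ≤ lam) {x : EuclideanSpace ℝ (Fin N)}
    (hx : x ∈ Ω) : ‖fderiv ℝ u x‖ ≤ lam := by
  have hC : ∀ y ∈ Ω, ContDiffAt ℝ 2 u y := fun y hy =>
    hu.contDiffAt (hV.mem_nhds (hΩV (subset_closure hy)))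
  have hnn : ∀ y ∈ closure Ω, 0 ≤ u y := fun y hy => by
    by_cases hyΩ : y ∈ Ω
    · exact (pos_of_lap_eq_neg_one hΩ hbd hV hΩV hu hΔu hu0 hyΩ).le
    · exact (hu0 y (by rw [hΩ.frontier_eq]; exact ⟨hy, hyΩ⟩)).ge
  refine le_of_forall_pos_le_add fun ε hε => ?_
  have hK : IsCompact (frontier Ω) :=
    hbd.isCompact_closure.of_isClosed_subset isClosed_frontier frontier_subset_closure
  obtain ⟨r, hr, hrO⟩ := hK.exists_thickening_subset_open
    (isOpen_sep_norm_fderiv_lt hV hu (lam + ε))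
    (fun y hy => ⟨hΩV (frontier_subset_closure hy), by linarith [hgrad y hy]⟩)
  have hmv : ∀ p ∈ frontier Ω, ∀ y ∈ ball p r, ∀ z ∈ ball p r,
      ‖u z - u y‖ ≤ (lam + ε) * ‖z - y‖ := fun p hp y hy z hz => by
    have hsub : ball p r ⊆ {y ∈ V | ‖fderiv ℝ u y‖ < lam + ε} :=
      (ball_subset_thickening hp r).trans hrO
    exact (convex_ball p r).norm_image_sub_le_of_norm_fderiv_le
      (fun q hq => (hu.contDiffAt (hV.mem_nhds (hsub hq).1)).differentiableAt (by norm_num))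
      (fun q hq => (hsub hq).2.le) hy hz
  have hshift : ∀ w : EuclideanSpace ℝ (Fin N), ‖w‖ < r → ∀ y ∈ Ω, y + w ∈ Ω →
      u (y + w) - u y ≤ (lam + ε) * ‖w‖ := by
    intro w hw y hy hyw
    have key : ∀ δ > 0, u (y + w) - (1 + δ) * u y ≤ (lam + ε) * ‖w‖ := by
      intro δ hδ
      have hcont : Continuous fun z : EuclideanSpace ℝ (Fin N) => z + w := by fun_prop
      have hWo : IsOpen (Ω ∩ (fun z => z + w) ⁻¹' Ω) := hΩ.inter (hΩ.preimage hcont)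
      have hcl1 : closure (Ω ∩ (fun z => z + w) ⁻¹' Ω) ⊆ closure Ω :=
        closure_mono inter_subset_left
      have hcl2 : MapsTo (fun z => z + w) (closure (Ω ∩ (fun z => z + w) ⁻¹' Ω)) (closure Ω) :=
        MapsTo.closure (fun z hz => hz.2) hcont
      have hCs : ∀ z ∈ Ω ∩ (fun z => z + w) ⁻¹' Ω,
          ContDiffAt ℝ 2 (fun z => u (z + w)) z := fun z hz =>
        ContDiffAt.comp (g := u) z (hC _ hz.2) (by fun_prop)
      refine le_of_lap_pos (f := fun z => u (z + w) - (1 + δ) * u z) hWo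
        (hbd.subset inter_subset_left) ?_ ?_ ?_ ?_ ⟨hy, hyw⟩
      · refine ContinuousOn.sub ?_ (continuousOn_const.mul (hu.continuousOn.mono
          (hcl1.trans hΩV)))
        exact (hu.continuousOn.mono hΩV).comp hcont.continuousOn hcl2
      · exact fun z hz => (hCs z hz).sub (contDiffAt_const.mul (hC z hz.1))
      · intro z hz
        rw [lap_sub_const_mul (hCs z hz) (hC z hz.1), lap_comp_add_right, hΔu _ hz.2,
          hΔu _ hz.1]
        linarith
      · intro z hz
        rw [hWo.frontier_eq] at hz
        have h1 : z ∈ closure Ω := hcl1 hz.1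
        have h2 : z + w ∈ closure Ω := hcl2 hz.1
        have h3 : u (z + w) - u z ≤ (lam + ε) * ‖w‖ := by
          have hle : ‖u (z + w) - u z‖ ≤ (lam + ε) * ‖z + w - z‖ := by
            by_cases hzΩ : z ∈ Ω
            · have hzw : z + w ∉ Ω := fun h => hz.2 ⟨hzΩ, h⟩
              exact hmv (z + w) (by rw [hΩ.frontier_eq]; exact ⟨h2, hzw⟩) z
                (by simpa [mem_ball, dist_eq_norm] using hw) _ (mem_ball_self hr)
            · exact hmv z (by rw [hΩ.frontier_eq]; exact ⟨h1, hzΩ⟩) z (mem_ball_self hr) _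
                (by simpa [mem_ball, dist_eq_norm] using hw)
          rw [add_sub_cancel_left] at hle
          exact (le_abs_self _).trans hle
        nlinarith [hnn z h1]
    have hlim : Tendsto (fun δ : ℝ => u (y + w) - (1 + δ) * u y) (𝓝[>] 0)
        (𝓝 (u (y + w) - (1 + 0) * u y)) :=
      (Continuous.tendsto (by fun_prop) (0 : ℝ)).mono_left nhdsWithin_le_nhds
    have := le_of_tendsto hlim (eventually_mem_nhdsWithin.mono key)
    simpa using this
  refine ((hC x hx).differentiableAt (by norm_num)).hasFDerivAt.le_of_lip' (by positivity) ?_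
  filter_upwards [hΩ.mem_nhds hx, ball_mem_nhds x hr] with y hy hyr
  rw [mem_ball, dist_eq_norm] at hyr
  rw [Real.norm_eq_abs, abs_sub_le_iff]
  constructor
  · have := hshift (y - x) hyr x hx (by simpa using hy)
    simpa using this
  · have := hshift (x - y) (by rwa [norm_sub_rev]) y hy (by simpa using hx)
    rw [norm_sub_rev y x]
    simpa using this

end Torsion

section Divergence

variable {N : ℕ} {u ψ : EuclideanSpace ℝ (Fin N) → ℝ}
  {G : EuclideanSpace ℝ (Fin N) → EuclideanSpace ℝ (Fin N)} {x : EuclideanSpace ℝ (Fin N)}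

lemma norm_gradient_eq (u : EuclideanSpace ℝ (Fin N) → ℝ) (x : EuclideanSpace ℝ (Fin N)) :
    ‖gradient u x‖ = ‖fderiv ℝ u x‖ :=
  LinearIsometryEquiv.norm_map _ _

lemma ContDiffAt.gradient (hu : ContDiffAt ℝ 2 u x) : ContDiffAt ℝ 1 (gradient u) x :=
  ((InnerProductSpace.toDual ℝ (EuclideanSpace ℝ (Fin N))).symm.toContinuousLinearEquiv
    |>.contDiff.contDiffAt).comp x (hu.fderiv_right (m := 1) (by norm_num))

lemma diverg_congr {G' : EuclideanSpace ℝ (Fin N) → EuclideanSpace ℝ (Fin N)}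
    (h : G =ᶠ[𝓝 x] G') : diverg G x = diverg G' x := by
  simp only [diverg, h.fderiv_eq]

lemma diverg_smul (hψ : DifferentiableAt ℝ ψ x) (hG : DifferentiableAt ℝ G x) :
    diverg (fun y => ψ y • G y) x = ψ x * diverg G x + fderiv ℝ ψ x (G x) := by
  have hGx : G x = ∑ i, G x i • (EuclideanSpace.single i 1 : EuclideanSpace ℝ (Fin N)) := by
    simpa using ((EuclideanSpace.basisFun (Fin N) ℝ).sum_repr (G x)).symm
  conv_rhs => rw [hGx]
  simp only [diverg, fderiv_fun_smul hψ hG, map_sum, map_smul, Finset.mul_sum,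
    ← Finset.sum_add_distrib]
  refine Finset.sum_congr rfl fun i _ => ?_
  simp [mul_comm]

lemma diverg_gradient (hu : ContDiffAt ℝ 2 u x) : diverg (gradient u) x = lap u x := by
  refine Finset.sum_congr rfl fun i _ => ?_
  have h1 : (fun y => fderiv ℝ u y (EuclideanSpace.single i 1)) = fun y => gradient u y i := by
    funext y
    rw [← toDual_gradient, InnerProductSpace.toDual_apply_apply,
      EuclideanSpace.inner_single_right]
    simp
  have h2 := ((EuclideanSpace.proj i : EuclideanSpace ℝ (Fin N) →L[ℝ] ℝ).hasFDerivAt.comp x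
    (hu.gradient.differentiableAt (by norm_num)).hasFDerivAt).fderiv
  rw [hessEntry, h1]
  exact (DFunLike.congr_fun h2 (EuclideanSpace.single i 1)).symm

lemma ContDiff.continuous_diverg (hG : ContDiff ℝ 1 G) : Continuous (diverg G) := by
  unfold diverg
  have := hG.continuous_fderiv (by norm_num)
  fun_prop

lemma integral_diverg_eq_zero (hG : ContDiff ℝ 1 G) (hc : HasCompactSupport G) :
    Integrable (diverg G) ∧ ∫ x, diverg G x = 0 := by
  have hint : ∀ i : Fin N,
      Integrable fun x => fderiv ℝ G x (EuclideanSpace.single i 1) := fun i =>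
    Continuous.integrable_of_hasCompactSupport
      ((hG.continuous_fderiv (by norm_num)).clm_apply continuous_const)
      (hc.fderiv_apply (𝕜 := ℝ) _)
  have hinti : ∀ i : Fin N,
      Integrable fun x => fderiv ℝ G x (EuclideanSpace.single i 1) i := fun i =>
    (EuclideanSpace.proj i : EuclideanSpace ℝ (Fin N) →L[ℝ] ℝ).integrable_comp (hint i)
  refine ⟨integrable_finsetSum _ fun i _ => hinti i, ?_⟩
  unfold diverg
  rw [integral_finsetSum _ fun i _ => hinti i]
  refine Finset.sum_eq_zero fun i _ => ?_
  have h0 : ∫ x, fderiv ℝ G x (EuclideanSpace.single i 1) = 0 := by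
    have := integral_smul_fderiv_eq_neg_fderiv_smul_of_integrable (μ := volume) (𝕜 := ℝ)
      (f := fun _ : EuclideanSpace ℝ (Fin N) => (1 : ℝ)) (g := G)
      (v := EuclideanSpace.single i 1)
      (by simp) (by simpa using hint i)
      (by simpa using hG.continuous.integrable_of_hasCompactSupport hc)
      (fun _ _ => differentiableAt_const _) (fun _ _ => hG.differentiable (by norm_num) _)
    simpa using this
  have := (EuclideanSpace.proj i : EuclideanSpace ℝ (Fin N) →L[ℝ] ℝ).integral_comp_comm (hint i)
  rw [h0] at this
  simpa using this

lemma fderiv_eq_zero_of_notMem_tsupport (hx : x ∉ tsupport ψ) : fderiv ℝ ψ x = 0 := by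
  rw [(notMem_tsupport_iff_eventuallyEq.1 hx).fderiv_eq]
  simp

lemma ContDiff.smul_of_tsupport_subset {O : Set (EuclideanSpace ℝ (Fin N))}
    (hψ : ContDiff ℝ 1 ψ) (hs : tsupport ψ ⊆ O) (hG : ∀ y ∈ O, ContDiffAt ℝ 1 G y) :
    ContDiff ℝ 1 fun y => ψ y • G y := by
  refine contDiff_iff_contDiffAt.2 fun y => ?_
  by_cases hy : y ∈ tsupport ψ
  · exact hψ.contDiffAt.smul (hG y (hs hy))
  · refine (contDiffAt_const (c := 0)).congr_of_eventuallyEq ?_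
    filter_upwards [notMem_tsupport_iff_eventuallyEq.1 hy] with z hz
    simp [hz]

/-- Integration by parts against a cutoff function. -/
lemma integral_mul_diverg_add_eq_zero {O : Set (EuclideanSpace ℝ (Fin N))}
    (hψ : ContDiff ℝ 1 ψ) (hc : HasCompactSupport ψ) (hs : tsupport ψ ⊆ O)
    (hG : ∀ y ∈ O, ContDiffAt ℝ 1 G y) :
    Integrable (fun x => ψ x * diverg G x + fderiv ℝ ψ x (G x)) ∧
      ∫ x, (ψ x * diverg G x + fderiv ℝ ψ x (G x)) = 0 := by
  have h := integral_diverg_eq_zero (hψ.smul_of_tsupport_subset hs hG) hc.smul_right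
  have heq : diverg (fun y => ψ y • G y) =
      fun x => ψ x * diverg G x + fderiv ℝ ψ x (G x) := by
    funext y
    by_cases hy : y ∈ tsupport ψ
    · exact diverg_smul (hψ.differentiable (by norm_num) y)
        ((hG y (hs hy)).differentiableAt (by norm_num))
    · have h0 := notMem_tsupport_iff_eventuallyEq.1 hy
      have : (fun y => ψ y • G y) =ᶠ[𝓝 y] fun _ => 0 := by
        filter_upwards [h0] with z hz
        simp [hz]
      rw [diverg_congr this, fderiv_eq_zero_of_notMem_tsupport hy, h0.self_of_nhds]
      simp [diverg]
  rwa [heq] at h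

end Divergence

section Perimeter

variable {N : ℕ} {Ω V A : Set (EuclideanSpace ℝ (Fin N))} {lam c : ℝ}
  {u : EuclideanSpace ℝ (Fin N) → ℝ}

lemma volume_div_le_perimeter (hbd : Bornology.IsBounded Ω)
    (hV : IsOpen V) (hΩV : closure Ω ⊆ V) (hu : ContDiffOn ℝ 2 u V)
    (hΔu : ∀ x ∈ Ω, lap u x = -1) (hc : 0 < c) (hgrad : ∀ x ∈ closure Ω, ‖fderiv ℝ u x‖ < c)
    (hA : A ⊆ Ω) (hAm : MeasurableSet A) :
    volume A / ENNReal.ofReal c ≤ perimeter A := by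
  obtain ⟨δ, hδ, hδO⟩ := hbd.isCompact_closure.exists_cthickening_subset_open
    (isOpen_sep_norm_fderiv_lt hV hu c) (fun y hy => ⟨hΩV hy, hgrad y hy⟩)
  obtain ⟨f, hf1, hf0, hf⟩ := exists_contMDiffMap_one_nhds_of_subset_interior
    (modelWithCornersSelf ℝ (EuclideanSpace ℝ (Fin N))) (n := 1)
    (s := closure Ω) (t := cthickening δ (closure Ω)) isClosed_closure
    ((self_subset_thickening hδ _).trans
      (isOpen_thickening.subset_interior_iff.2 (thickening_subset_cthickening δ _)))
  set φ : EuclideanSpace ℝ (Fin N) → ℝ := fun x => f x * (-c⁻¹) with hφdef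
  have hφC : ContDiff ℝ 1 φ := f.contMDiff.contDiff.mul contDiff_const
  have hφs : tsupport φ ⊆ {y ∈ V | ‖fderiv ℝ u y‖ < c} := by
    refine (closure_minimal (fun y hy => ?_) isClosed_cthickening).trans hδO
    by_contra h
    exact hy (by simp [hφdef, hf0 y h])
  have hGC : ∀ y ∈ {y ∈ V | ‖fderiv ℝ u y‖ < c}, ContDiffAt ℝ 1 (gradient u) y :=
    fun y hy => (hu.contDiffAt (hV.mem_nhds hy.1)).gradient
  have hnorm : ∀ x, ‖φ x • gradient u x‖ ≤ 1 := fun x => by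
    by_cases hx : x ∈ tsupport φ
    · have h1 : |f x| ≤ 1 := abs_le.2 ⟨by linarith [(hf x).1], (hf x).2⟩
      have h2 : ‖gradient u x‖ ≤ c := by rw [norm_gradient_eq]; exact (hφs hx).2.le
      rw [norm_smul, hφdef, Real.norm_eq_abs, abs_mul, abs_neg, abs_of_pos (inv_pos.2 hc)]
      calc |f x| * c⁻¹ * ‖gradient u x‖ ≤ 1 * c⁻¹ * c := by gcongr
        _ = 1 := by field_simp
    · simp [image_eq_zero_of_notMem_tsupport hx]
  have hdiv : ∀ x ∈ A, diverg (fun y => φ y • gradient u y) x = c⁻¹ := fun x hx => by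
    have hxc : x ∈ closure Ω := subset_closure (hA hx)
    have hux : ContDiffAt ℝ 2 u x := hu.contDiffAt (hV.mem_nhds (hΩV hxc))
    have hev : (fun y => φ y • gradient u y) =ᶠ[𝓝 x] fun y => (-c⁻¹) • gradient u y := by
      filter_upwards [hf1.filter_mono (nhds_le_nhdsSet hxc)] with y hy
      simp [hφdef, hy]
    rw [diverg_congr hev, diverg_smul (differentiableAt_const _)
      (hux.gradient.differentiableAt (by norm_num)), diverg_gradient hux, hΔu x (hA hx)]
    simp
  refine le_trans (le_of_eq ?_) (le_iSup (fun ξ : {ξ : EuclideanSpace ℝ (Fin N) →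
    EuclideanSpace ℝ (Fin N) // ContDiff ℝ 1 ξ ∧ ∀ x, ‖ξ x‖ ≤ 1} =>
      ENNReal.ofReal (∫ x in A, diverg ξ.1 x))
    ⟨_, hφC.smul_of_tsupport_subset hφs hGC, hnorm⟩)
  have hfin : volume A ≠ ⊤ := (hbd.subset hA).measure_lt_top.ne
  rw [setIntegral_congr_fun hAm hdiv, setIntegral_const, smul_eq_mul,
    ENNReal.ofReal_mul measureReal_nonneg, ofReal_measureReal hfin,
    ENNReal.ofReal_inv_of_pos hc, div_eq_mul_inv]

lemma volume_le_mul_perimeter (hbd : Bornology.IsBounded Ω)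
    (hV : IsOpen V) (hΩV : closure Ω ⊆ V) (hu : ContDiffOn ℝ 2 u V)
    (hΔu : ∀ x ∈ Ω, lap u x = -1) (hlam : 0 < lam)
    (hgrad : ∀ x ∈ closure Ω, ‖fderiv ℝ u x‖ ≤ lam) (hA : A ⊆ Ω) (hAm : MeasurableSet A) :
    volume A ≤ ENNReal.ofReal lam * perimeter A := by
  have hlim : Tendsto (fun c : ℝ => ENNReal.ofReal c * perimeter A) (𝓝[>] lam)
      (𝓝 (ENNReal.ofReal lam * perimeter A)) :=
    ENNReal.Tendsto.mul_const
      ((ENNReal.continuous_ofReal.tendsto lam).mono_left nhdsWithin_le_nhds)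
      (Or.inl (ENNReal.ofReal_pos.2 hlam).ne')
  refine ge_of_tendsto hlim (eventually_mem_nhdsWithin.mono fun c hc => ?_)
  have hc0 : 0 < c := hlam.trans hc
  have := volume_div_le_perimeter hbd hV hΩV hu hΔu hc0
    (fun x hx => (hgrad x hx).trans_lt hc) hA hAm
  rwa [ENNReal.div_le_iff' (ENNReal.ofReal_pos.2 hc0).ne' ENNReal.ofReal_ne_top] at this

lemma contDiff_cutoff (hΩ : IsOpen Ω) (hbd : Bornology.IsBounded Ω) (hV : IsOpen V)
    (hΩV : closure Ω ⊆ V) (hu : ContDiffOn ℝ 2 u V) (hu0 : ∀ x ∈ frontier Ω, u x = 0)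
    {φ : ℝ → ℝ} (hφ : ContDiff ℝ 1 φ) {ε : ℝ} (hε : 0 < ε) (hφ0 : ∀ t ≤ ε, φ t = 0) :
    ContDiff ℝ 1 (Ω.indicator fun x => φ (u x)) ∧
      HasCompactSupport (Ω.indicator fun x => φ (u x)) ∧
      tsupport (Ω.indicator fun x => φ (u x)) ⊆ Ω := by
  have huc : ContinuousOn u (closure Ω) := hu.continuousOn.mono hΩV
  have hK : IsCompact (closure Ω ∩ u ⁻¹' Ici ε) :=
    hbd.isCompact_closure.of_isClosed_subset
      (huc.preimage_isClosed_of_isClosed isClosed_closure isClosed_Ici) inter_subset_left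
  have hKΩ : closure Ω ∩ u ⁻¹' Ici ε ⊆ Ω := fun x hx => by
    by_contra h
    have h1 := hu0 x (by rw [hΩ.frontier_eq]; exact ⟨hx.1, h⟩)
    have h2 : ε ≤ u x := hx.2
    linarith
  have hts : tsupport (Ω.indicator fun x => φ (u x)) ⊆ closure Ω ∩ u ⁻¹' Ici ε := by
    refine closure_minimal (fun x hx => ?_) hK.isClosed
    have hxΩ : x ∈ Ω := by
      by_contra h
      exact hx (indicator_of_notMem h _)
    refine ⟨subset_closure hxΩ, ?_⟩
    by_contra h
    exact hx (by rw [indicator_of_mem hxΩ]; exact hφ0 _ (not_le.1 h).le)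
  refine ⟨contDiff_iff_contDiffAt.2 fun x => ?_,
    hK.of_isClosed_subset (isClosed_tsupport _) hts, hts.trans hKΩ⟩
  by_cases hx : x ∈ Ω
  · have h1 : ContDiffAt ℝ 1 (fun x => φ (u x)) x := hφ.contDiffAt.comp x
      ((hu.contDiffAt (hV.mem_nhds (hΩV (subset_closure hx)))).of_le (by norm_num))
    refine h1.congr_of_eventuallyEq ?_
    filter_upwards [hΩ.mem_nhds hx] with y hy
    rw [indicator_of_mem hy]
  · exact contDiffAt_const.congr_of_eventuallyEq
      (notMem_tsupport_iff_eventuallyEq.1 fun h => hx (hKΩ (hts h)))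

lemma integral_cutoff_mul_diverg_le (hΩ : IsOpen Ω) (hbd : Bornology.IsBounded Ω)
    (hV : IsOpen V) (hΩV : closure Ω ⊆ V) (hu : ContDiffOn ℝ 2 u V)
    (hΔu : ∀ x ∈ Ω, lap u x = -1) (hu0 : ∀ x ∈ frontier Ω, u x = 0) (hc : 0 < c)
    {φ : ℝ → ℝ} (hφ : ContDiff ℝ 1 φ) (hφm : Monotone φ) (hφ1 : ∀ t, φ t ≤ 1) {ε ε' : ℝ}
    (hε : 0 < ε) (hφ0 : ∀ t ≤ ε, φ t = 0) (hφε' : ∀ t ≥ ε', deriv φ t = 0)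
    (hgrad : ∀ x ∈ Ω, u x < ε' → c ≤ ‖fderiv ℝ u x‖)
    {ξ : EuclideanSpace ℝ (Fin N) → EuclideanSpace ℝ (Fin N)} (hξ : ContDiff ℝ 1 ξ)
    (hξ1 : ∀ x, ‖ξ x‖ ≤ 1) :
    ∫ x in Ω, φ (u x) * diverg ξ x ≤ volume.real Ω / c := by
  set ψ : EuclideanSpace ℝ (Fin N) → ℝ := Ω.indicator fun x => φ (u x) with hψdef
  obtain ⟨hψC, hψc, hψs⟩ := contDiff_cutoff hΩ hbd hV hΩV hu hu0 hφ hε hφ0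
  rw [← hψdef] at hψC hψc hψs
  have hC : ∀ y ∈ Ω, ContDiffAt ℝ 2 u y := fun y hy =>
    hu.contDiffAt (hV.mem_nhds (hΩV (subset_closure hy)))
  have hψΩ : ∀ x ∈ Ω, ψ x = φ (u x) := fun x hx => indicator_of_mem hx _
  have hψ0 : ∀ x ∉ Ω, ψ x = 0 := fun x hx => indicator_of_notMem hx _
  have hDψ0 : ∀ x ∉ Ω, fderiv ℝ ψ x = 0 := fun x hx =>
    fderiv_eq_zero_of_notMem_tsupport fun h => hx (hψs h)
  have hDψ : ∀ x ∈ Ω, fderiv ℝ ψ x = deriv φ (u x) • fderiv ℝ u x := fun x hx => by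
    have hev : ψ =ᶠ[𝓝 x] fun x => φ (u x) := by
      filter_upwards [hΩ.mem_nhds hx] with y hy using hψΩ y hy
    rw [hev.fderiv_eq]
    exact ((hφ.differentiable (by norm_num) (u x)).hasDerivAt.comp_hasFDerivAt x
      ((hC x hx).differentiableAt (by norm_num)).hasFDerivAt).fderiv
  obtain ⟨hI1, hI1'⟩ := integral_mul_diverg_add_eq_zero hψC hψc hψs
    (G := ξ) (fun y _ => hξ.contDiffAt)
  obtain ⟨hI2, hI2'⟩ := integral_mul_diverg_add_eq_zero hψC hψc hψs
    (G := gradient u) (fun y hy => (hC y hy).gradient)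
  have hψint : Integrable ψ := hψC.continuous.integrable_of_hasCompactSupport hψc
  have hψle : ∫ x, ψ x ≤ volume.real Ω := by
    rw [hψdef, integral_indicator hΩ.measurableSet]
    have hfin : volume Ω < ⊤ := hbd.measure_lt_top
    calc ∫ x in Ω, φ (u x) ≤ ∫ _ in Ω, (1 : ℝ) :=
          setIntegral_mono_on ((integrable_indicator_iff hΩ.measurableSet).1 hψint)
            (integrableOn_const hfin.ne) hΩ.measurableSet fun x _ => hφ1 _
      _ = volume.real Ω := by simp
  have hlhs : ∫ x in Ω, φ (u x) * diverg ξ x = ∫ x, ψ x * diverg ξ x := by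
    rw [← integral_indicator hΩ.measurableSet]
    refine integral_congr_ae (ae_of_all _ fun x => ?_)
    by_cases hx : x ∈ Ω
    · simp [hx, hψΩ x hx]
    · simp [hx, hψ0 x hx]
  have hξint : Integrable fun x => ψ x * diverg ξ x :=
    (hψC.continuous.mul hξ.continuous_diverg).integrable_of_hasCompactSupport hψc.mul_right
  have hpt : ∀ x, ψ x * diverg ξ x ≤ (ψ x * diverg ξ x + fderiv ℝ ψ x (ξ x)) +
      (ψ x + (ψ x * diverg (gradient u) x + fderiv ℝ ψ x (gradient u x))) / c := fun x => by
    by_cases hx : x ∈ Ω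
    · rw [diverg_gradient (hC x hx), hΔu x hx, hDψ x hx]
      have hgg : fderiv ℝ u x (gradient u x) = ‖fderiv ℝ u x‖ ^ 2 := by
        rw [← norm_gradient_eq, ← toDual_gradient, InnerProductSpace.toDual_apply_apply,
          real_inner_self_eq_norm_sq]
      have hξx : -‖fderiv ℝ u x‖ ≤ fderiv ℝ u x (ξ x) := by
        have h1 := (fderiv ℝ u x).le_opNorm (ξ x)
        have h2 : ‖fderiv ℝ u x‖ * ‖ξ x‖ ≤ ‖fderiv ℝ u x‖ * 1 := by
          gcongr
          exact hξ1 x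
        have h3 := neg_abs_le (fderiv ℝ u x (ξ x))
        rw [Real.norm_eq_abs] at h1
        linarith
      have hd : 0 ≤ deriv φ (u x) := hφm.deriv_nonneg
      have hkey : 0 ≤ deriv φ (u x) * (fderiv ℝ u x (ξ x) + ‖fderiv ℝ u x‖ ^ 2 / c) := by
        rcases lt_or_ge (u x) ε' with h | h
        · refine mul_nonneg hd ?_
          have h1 : ‖fderiv ℝ u x‖ ≤ ‖fderiv ℝ u x‖ ^ 2 / c := by
            rw [le_div_iff₀ hc, sq]
            exact mul_le_mul_of_nonneg_left (hgrad x hx h) (norm_nonneg _)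
          linarith
        · simp [hφε' _ h]
      simp only [smul_apply, smul_eq_mul, hgg]
      have : deriv φ (u x) * (fderiv ℝ u x (ξ x) + ‖fderiv ℝ u x‖ ^ 2 / c) =
        deriv φ (u x) * fderiv ℝ u x (ξ x) +
          (ψ x + (ψ x * -1 + deriv φ (u x) * ‖fderiv ℝ u x‖ ^ 2)) / c := by ring
      linarith
    · simp [hψ0 x hx, hDψ0 x hx]
  have hI3 : Integrable fun x =>
      ψ x + (ψ x * diverg (gradient u) x + fderiv ℝ ψ x (gradient u x)) := hψint.add hI2
  rw [hlhs]
  calc ∫ x, ψ x * diverg ξ x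
      ≤ ∫ x, ((ψ x * diverg ξ x + fderiv ℝ ψ x (ξ x)) +
        (ψ x + (ψ x * diverg (gradient u) x + fderiv ℝ ψ x (gradient u x))) / c) :=
        integral_mono hξint (hI1.add (hI3.div_const c)) hpt
    _ = (∫ x, ψ x) / c := by
        rw [integral_add hI1 (hI3.div_const c), integral_div,
          integral_add hψint hI2, hI1', hI2']
        simp
    _ ≤ volume.real Ω / c := by gcongr

lemma setIntegral_diverg_le (hΩ : IsOpen Ω) (hbd : Bornology.IsBounded Ω)
    (hV : IsOpen V) (hΩV : closure Ω ⊆ V) (hu : ContDiffOn ℝ 2 u V)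
    (hΔu : ∀ x ∈ Ω, lap u x = -1) (hu0 : ∀ x ∈ frontier Ω, u x = 0) (hc : 0 < c)
    (hgrad : ∀ x ∈ frontier Ω, c < ‖fderiv ℝ u x‖)
    {ξ : EuclideanSpace ℝ (Fin N) → EuclideanSpace ℝ (Fin N)} (hξ : ContDiff ℝ 1 ξ)
    (hξ1 : ∀ x, ‖ξ x‖ ≤ 1) :
    ∫ x in Ω, diverg ξ x ≤ volume.real Ω / c := by
  have hpos : ∀ x ∈ Ω, 0 < u x := fun x hx =>
    pos_of_lap_eq_neg_one hΩ hbd hV hΩV hu hΔu hu0 hx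
  have huc : ContinuousOn u (closure Ω) := hu.continuousOn.mono hΩV
  have hfc : ContinuousOn (fun x => ‖fderiv ℝ u x‖) (closure Ω) :=
    ((hu.continuousOn_fderiv_of_isOpen hV (by norm_num)).mono hΩV).norm
  obtain ⟨ε', hε', hnear⟩ : ∃ ε' > 0, ∀ x ∈ Ω, u x < ε' → c ≤ ‖fderiv ℝ u x‖ := by
    set K := closure Ω ∩ (fun x => ‖fderiv ℝ u x‖) ⁻¹' Iic c with hKdef
    have hK : IsCompact K := hbd.isCompact_closure.of_isClosed_subset
      (hfc.preimage_isClosed_of_isClosed isClosed_closure isClosed_Iic) inter_subset_left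
    have hKpos : ∀ x ∈ K, 0 < u x := fun x hx => hpos x <| by
      by_contra h
      exact (hgrad x (by rw [hΩ.frontier_eq]; exact ⟨hx.1, h⟩)).not_ge hx.2
    rcases K.eq_empty_or_nonempty with hKe | hKne
    · refine ⟨1, one_pos, fun x hx _ => ?_⟩
      by_contra! h
      have : x ∈ K := ⟨subset_closure hx, h.le⟩
      simp [hKe] at this
    · obtain ⟨y, hy, hmin⟩ := hK.exists_isMinOn hKne (huc.mono inter_subset_left)
      refine ⟨u y, hKpos y hy, fun x hx hxy => ?_⟩
      by_contra! h
      exact hxy.not_ge (hmin (⟨subset_closure hx, h.le⟩ : x ∈ K))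
  set φ : ℝ → ℝ → ℝ := fun ε t => Real.smoothTransition (2 * t / ε - 1) with hφdef
  have hle : ∀ᶠ ε in 𝓝[>] (0 : ℝ), ∫ x in Ω, φ ε (u x) * diverg ξ x ≤ volume.real Ω / c := by
    filter_upwards [Ioo_mem_nhdsGT hε'] with ε hε
    have hε0 : 0 < ε := hε.1
    refine integral_cutoff_mul_diverg_le hΩ hbd hV hΩV hu hΔu hu0 hc (φ := φ ε) (ε := ε / 2)
      (ε' := ε') ?_ ?_ (fun t => Real.smoothTransition.le_one _) (half_pos hε0) ?_ ?_ hnear hξ hξ1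
    · exact Real.smoothTransition.contDiff.comp (by fun_prop)
    · intro s t hst
      exact Real.smoothTransition.monotone (by gcongr)
    · intro t ht
      refine Real.smoothTransition.zero_of_nonpos ?_
      rw [sub_nonpos, div_le_one hε0]
      linarith
    · intro t ht
      have : φ ε =ᶠ[𝓝 t] fun _ => 1 := by
        filter_upwards [Ioi_mem_nhds (hε.2.trans_le ht)] with s hs
        refine Real.smoothTransition.one_of_one_le ?_
        rw [le_sub_iff_add_le, le_div_iff₀ hε0]
        linarith [mem_Ioi.1 hs]
      rw [this.deriv_eq]
      simp
  have hdint : IntegrableOn (diverg ξ) Ω :=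
    (hξ.continuous_diverg.continuousOn.integrableOn_compact hbd.isCompact_closure).mono_set
      subset_closure
  have hlim : Tendsto (fun ε => ∫ x in Ω, φ ε (u x) * diverg ξ x) (𝓝[>] 0)
      (𝓝 (∫ x in Ω, diverg ξ x)) := by
    refine tendsto_integral_filter_of_dominated_convergence (fun x => ‖diverg ξ x‖) ?_ ?_
      hdint.norm ?_
    · refine Eventually.of_forall fun ε => ContinuousOn.aestronglyMeasurable ?_ hΩ.measurableSet
      refine ContinuousOn.mul ?_ hξ.continuous_diverg.continuousOn
      have : Continuous (φ ε) := Real.smoothTransition.continuous.comp (by fun_prop)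
      exact this.comp_continuousOn (huc.mono subset_closure)
    · refine Eventually.of_forall fun ε => ae_of_all _ fun x => ?_
      rw [norm_mul, Real.norm_of_nonneg (Real.smoothTransition.nonneg _)]
      exact mul_le_of_le_one_left (norm_nonneg _) (Real.smoothTransition.le_one _)
    · refine (ae_restrict_iff' hΩ.measurableSet).2 (ae_of_all _ fun x hx => ?_)
      refine tendsto_const_nhds.congr' ?_
      filter_upwards [Ioo_mem_nhdsGT (hpos x hx)] with ε hε
      have : φ ε (u x) = 1 := by
        refine Real.smoothTransition.one_of_one_le ?_
        rw [le_sub_iff_add_le, le_div_iff₀ hε.1]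
        linarith [hε.2]
      rw [this, one_mul]
  exact le_of_tendsto hlim hle

lemma perimeter_le_volume_div (hΩ : IsOpen Ω) (hbd : Bornology.IsBounded Ω)
    (hV : IsOpen V) (hΩV : closure Ω ⊆ V) (hu : ContDiffOn ℝ 2 u V)
    (hΔu : ∀ x ∈ Ω, lap u x = -1) (hu0 : ∀ x ∈ frontier Ω, u x = 0) (hlam : 0 < lam)
    (hgrad : ∀ x ∈ frontier Ω, lam ≤ ‖fderiv ℝ u x‖) :
    perimeter Ω ≤ volume Ω / ENNReal.ofReal lam := by
  refine iSup_le fun ξ => ?_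
  have hlim : Tendsto (fun c : ℝ => volume.real Ω / c) (𝓝[<] lam) (𝓝 (volume.real Ω / lam)) :=
    (tendsto_const_nhds.div tendsto_id hlam.ne').mono_left nhdsWithin_le_nhds
  have hle : ∫ x in Ω, diverg ξ.1 x ≤ volume.real Ω / lam := by
    refine ge_of_tendsto hlim ?_
    filter_upwards [Ioo_mem_nhdsLT hlam] with c hc
    exact setIntegral_diverg_le hΩ hbd hV hΩV hu hΔu hu0 hc.1
      (fun x hx => hc.2.trans_le (hgrad x hx)) ξ.2.1 ξ.2.2
  calc ENNReal.ofReal (∫ x in Ω, diverg ξ.1 x)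
      ≤ ENNReal.ofReal (volume.real Ω / lam) := ENNReal.ofReal_le_ofReal hle
    _ = volume Ω / ENNReal.ofReal lam := by
      rw [ENNReal.ofReal_div_of_pos hlam, ofReal_measureReal hbd.measure_lt_top.ne]

end Perimeter

/-- Euclidean case of Theorem 2 (self-Cheeger property): if `Ω ⊆ ℝ^N` (`N ≥ 2`) is a
nonempty bounded open set with compact `C²` boundary, `λ > 0`, and `u` is `C²` on an open
neighborhood of `closure Ω` with `Δu = -1` in `Ω`, `u = 0` and `‖∇u‖ = λ` on `∂Ω`, then
every measurable `A ⊆ Ω` satisfies `vol(A) ≤ λ · P(A)`, `P(Ω) = vol(Ω)/λ`, and the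
Cheeger constant of `Ω` equals `1/λ` and is attained by `Ω` itself. -/
theorem self_cheeger_euclidean {N : ℕ} (hN : 2 ≤ N)
    {Ω : Set (EuclideanSpace ℝ (Fin N))} (hne : Ω.Nonempty) (hΩ : IsOpen Ω)
    (hbd : Bornology.IsBounded Ω) (hcpt : IsCompact (frontier Ω))
    (hsurf : IsC2Hypersurface (frontier Ω)) {lam : ℝ} (hlam : 0 < lam)
    {u : EuclideanSpace ℝ (Fin N) → ℝ}
    (hu : ∃ V : Set (EuclideanSpace ℝ (Fin N)),
      IsOpen V ∧ closure Ω ⊆ V ∧ ContDiffOn ℝ 2 u V)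
    (hΔu : ∀ x ∈ Ω, lap u x = -1)
    (hu0 : ∀ x ∈ frontier Ω, u x = 0)
    (hgrad : ∀ x ∈ frontier Ω, ‖gradient u x‖ = lam) :
    (∀ A : Set (EuclideanSpace ℝ (Fin N)), A ⊆ Ω → MeasurableSet A →
      volume A ≤ ENNReal.ofReal lam * perimeter A) ∧
    perimeter Ω = volume Ω / ENNReal.ofReal lam ∧
    cheegerConstant Ω = 1 / ENNReal.ofReal lam ∧
    perimeter Ω / volume Ω = 1 / ENNReal.ofReal lam := by
  obtain ⟨V, hV, hΩV, huV⟩ := hu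
  have hgrad' : ∀ x ∈ frontier Ω, ‖fderiv ℝ u x‖ = lam := fun x hx => by
    rw [← norm_gradient_eq, hgrad x hx]
  have hgradc : ∀ x ∈ closure Ω, ‖fderiv ℝ u x‖ ≤ lam := fun x hx => by
    by_cases hxΩ : x ∈ Ω
    · exact norm_fderiv_le_of_lap_eq_neg_one hΩ hbd hV hΩV huV hΔu hu0 hlam
        (fun y hy => (hgrad' y hy).le) hxΩ
    · exact (hgrad' x (by rw [hΩ.frontier_eq]; exact ⟨hx, hxΩ⟩)).le
  have hA : ∀ A : Set (EuclideanSpace ℝ (Fin N)), A ⊆ Ω → MeasurableSet A →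
      volume A ≤ ENNReal.ofReal lam * perimeter A := fun A hAΩ hAm =>
    volume_le_mul_perimeter hbd hV hΩV huV hΔu hlam hgradc hAΩ hAm
  have hl0 : ENNReal.ofReal lam ≠ 0 := (ENNReal.ofReal_pos.2 hlam).ne'
  have hvol0 : volume Ω ≠ 0 := (hΩ.measure_pos volume hne).ne'
  have hvolt : volume Ω ≠ ⊤ := hbd.measure_lt_top.ne
  have hP : perimeter Ω = volume Ω / ENNReal.ofReal lam :=
    le_antisymm
      (perimeter_le_volume_div hΩ hbd hV hΩV huV hΔu hu0 hlam fun x hx => (hgrad' x hx).ge)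
      (ENNReal.div_le_of_le_mul' (hA Ω subset_rfl hΩ.measurableSet))
  have hPt : perimeter Ω < ⊤ := by
    rw [hP]
    exact ENNReal.div_lt_top hvolt hl0
  have hq : perimeter Ω / volume Ω = 1 / ENNReal.ofReal lam := by
    rw [hP, div_eq_mul_inv, div_eq_mul_inv, mul_right_comm, ENNReal.mul_inv_cancel hvol0 hvolt,
      one_div, one_mul]
  refine ⟨hA, hP, le_antisymm ?_ ?_, hq⟩
  · rw [← hq]
    exact iInf₂_le Ω ⟨subset_rfl, hΩ.measurableSet, pos_iff_ne_zero.2 hvol0, hPt⟩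
  · refine le_iInf₂ fun A ⟨hAΩ, hAm, hA0, _⟩ => ?_
    have hAt : volume A ≠ ⊤ := (hbd.subset hAΩ).measure_lt_top.ne
    rw [ENNReal.le_div_iff_mul_le (Or.inl hA0.ne') (Or.inl hAt), one_div, mul_comm,
      ← div_eq_mul_inv]
    exact ENNReal.div_le_of_le_mul' (hA A hAΩ hAm)

end
end
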